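/- Let ω be a concave modulus of continuity satisfying the Dini condition. For every t ∈ (0, 2π) and every f ∈ H_ω, one has max_x |f̃(x+t) − f̃(x)| ≤ (2/π) ∫₀^{t/2} [sin(t/2)/(cos u − cos(t/2))] · ω(ρ(u) − u) du, where ρ(u) ∈ (t/2, π) is the unique solution of ∫₀^{u} sin(t/2)/(cos v − cos(t/2)) dv = −∫_{ρ(u)}^{π} sin(t/2)/(cos v − cos(t/2)) dv for 0 < u < t/2. -/

import Mathlib

open MeasureTheory Real Filter Set

noncomputable section

/-- ω is a concave modulus of continuity. -/
def IsConcaveModulus (ω : ℝ → ℝ) : Prop :=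
  Continuous ω ∧ MonotoneOn ω (Ici 0) ∧ ω 0 = 0 ∧
    (∀ s t : ℝ, 0 ≤ s → 0 ≤ t → ω (s + t) ≤ ω s + ω t) ∧
    (∀ t : ℝ, 0 ≤ t → 0 ≤ ω t) ∧ ConcaveOn ℝ (Ici 0) ω

/-- The Dini condition: ∫₀^ε ω(t)/t dt < ∞ for some ε > 0. -/
def DiniCondition (ω : ℝ → ℝ) : Prop :=
  ∃ ε > 0, IntegrableOn (fun t => ω t / t) (Ioo 0 ε)

/-- f is 2π-periodic with modulus of continuity bounded by ω. -/
def MemH (ω f : ℝ → ℝ) : Prop :=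
  Function.Periodic f (2 * π) ∧ ∀ x y : ℝ, |f x - f y| ≤ ω |x - y|

/-- The principal value integral defining the conjugate function converges to L at x. -/
def ConjAt (f : ℝ → ℝ) (x L : ℝ) : Prop :=
  Tendsto (fun δ : ℝ =>
      -(1 / π) * ∫ t in {t : ℝ | δ ≤ |t - x| ∧ |t - x| ≤ π},
        f t / (2 * Real.tan ((t - x) / 2)))
    (nhdsWithin 0 (Ioi 0)) (nhds L)

/-- g is the trigonometric conjugate of f. -/
def ConjFn (f g : ℝ → ℝ) : Prop := ∀ x : ℝ, ConjAt f x (g x)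

/-- f belongs to W^r H_ω. -/
def MemWrH (r : ℕ) (ω f : ℝ → ℝ) : Prop :=
  Function.Periodic f (2 * π) ∧ ContDiff ℝ r f ∧
    ∀ x y : ℝ, |iteratedDeriv r f x - iteratedDeriv r f y| ≤ ω |x - y|

/-- The kernel of the difference of two conjugate values at distance `2 * h`, centred at their
midpoint. -/
def diffKernel (h v : ℝ) : ℝ := Real.sin h / (Real.cos v - Real.cos h)

/-- The decreasing involution of `(0, π)` fixing `h` under which the primitive of `diffKernel h`
vanishing at `0` is invariant. -/
def reflectPt (h u : ℝ) : ℝ := 2 * Real.arctan (Real.tan (h / 2) ^ 2 / Real.tan (u / 2))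

lemma tan_half_pos {u : ℝ} (hu : u ∈ Ioo 0 π) : 0 < Real.tan (u / 2) :=
  Real.tan_pos_of_pos_of_lt_pi_div_two (by linarith [hu.1]) (by linarith [hu.2])

lemma cos_half_pos {u : ℝ} (hu : u ∈ Ioo 0 π) : 0 < Real.cos (u / 2) :=
  Real.cos_pos_of_mem_Ioo ⟨by linarith [hu.1, Real.pi_pos], by linarith [hu.2]⟩

lemma tan_half_reflectPt (h u : ℝ) :
    Real.tan (reflectPt h u / 2) = Real.tan (h / 2) ^ 2 / Real.tan (u / 2) := by
  rw [reflectPt, mul_div_cancel_left₀ _ two_ne_zero, Real.tan_arctan]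

lemma reflectPt_mem {h u : ℝ} (hh : h ∈ Ioo 0 π) (hu : u ∈ Ioo 0 π) :
    reflectPt h u ∈ Ioo 0 π := by
  have h1 : 0 < Real.tan (h / 2) ^ 2 / Real.tan (u / 2) :=
    div_pos (pow_pos (tan_half_pos hh) 2) (tan_half_pos hu)
  have h2 := Real.arctan_pos.2 h1
  have h3 := Real.arctan_lt_pi_div_two (Real.tan (h / 2) ^ 2 / Real.tan (u / 2))
  constructor <;> unfold reflectPt <;> linarith

lemma two_arctan_tan_half {u : ℝ} (hu : u ∈ Ioo 0 π) : 2 * Real.arctan (Real.tan (u / 2)) = u := by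
  rw [Real.arctan_tan (by linarith [hu.1, Real.pi_pos]) (by linarith [hu.2])]
  ring

lemma reflectPt_reflectPt {h u : ℝ} (hh : h ∈ Ioo 0 π) (hu : u ∈ Ioo 0 π) :
    reflectPt h (reflectPt h u) = u := by
  have h1 := tan_half_pos hh
  have h2 := tan_half_pos hu
  rw [reflectPt, tan_half_reflectPt, div_div_cancel₀ (pow_pos h1 2).ne', two_arctan_tan_half hu]

lemma reflectPt_self {h : ℝ} (hh : h ∈ Ioo 0 π) : reflectPt h h = h := by
  have h1 := (tan_half_pos hh).ne'
  rw [reflectPt, pow_two, mul_div_cancel_right₀ _ h1, two_arctan_tan_half hh]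

lemma reflectPt_strictAntiOn {h : ℝ} (hh : h ∈ Ioo 0 π) :
    StrictAntiOn (reflectPt h) (Ioo 0 π) := by
  intro u hu w hw huw
  have h1 : Real.tan (u / 2) < Real.tan (w / 2) :=
    Real.tan_lt_tan_of_lt_of_lt_pi_div_two (by linarith [hu.1, Real.pi_pos])
      (by linarith [hw.2]) (by linarith)
  have h2 := Real.arctan_strictMono
    (div_lt_div_of_pos_left (pow_pos (tan_half_pos hh) 2) (tan_half_pos hu) h1)
  unfold reflectPt
  linarith

lemma reflectPt_image {h u : ℝ} (hh : h ∈ Ioo 0 π) (hu : u ∈ Ioo 0 π) :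
    reflectPt h '' Ioo 0 u = Ioo (reflectPt h u) π := by
  have hanti := reflectPt_strictAntiOn hh
  ext v
  constructor
  · rintro ⟨w, hw, rfl⟩
    have hw' : w ∈ Ioo 0 π := ⟨hw.1, hw.2.trans hu.2⟩
    exact ⟨hanti hw' hu hw.2, (reflectPt_mem hh hw').2⟩
  · intro hv
    have hv' : v ∈ Ioo 0 π := ⟨(reflectPt_mem hh hu).1.trans hv.1, hv.2⟩
    refine ⟨reflectPt h v, ⟨(reflectPt_mem hh hv').1, ?_⟩, reflectPt_reflectPt hh hv'⟩
    simpa only [reflectPt_reflectPt hh hu] using hanti (reflectPt_mem hh hu) hv' hv.1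

/-- The derivative of `reflectPt h` at `u`. -/
def reflectDeriv (h u : ℝ) : ℝ :=
  -(Real.tan (h / 2) ^ 2 * (1 + Real.tan (u / 2) ^ 2) /
    (Real.tan (u / 2) ^ 2 + Real.tan (h / 2) ^ 4))

lemma hasDerivAt_reflectPt (h : ℝ) {u : ℝ} (hu : u ∈ Ioo 0 π) :
    HasDerivAt (reflectPt h) (reflectDeriv h u) u := by
  have ha := tan_half_pos hu
  have hc := cos_half_pos hu
  have h1 : HasDerivAt (fun x : ℝ => Real.tan (x / 2)) (1 / Real.cos (u / 2) ^ 2 * (1 / 2)) u :=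
    HasDerivAt.comp (h₂ := Real.tan) (h := fun x : ℝ => x / 2) u (Real.hasDerivAt_tan hc.ne')
      ((hasDerivAt_id u).div_const 2)
  have h2 := (((hasDerivAt_const u (Real.tan (h / 2) ^ 2)).div h1 ha.ne').arctan).const_mul 2
  refine h2.congr_deriv ?_
  have h3 : 1 / Real.cos (u / 2) ^ 2 = 1 + Real.tan (u / 2) ^ 2 := by
    rw [one_div, Real.inv_one_add_tan_sq hc.ne' |>.symm, inv_inv]
  simp only [h3, Pi.div_apply]
  unfold reflectDeriv
  generalize Real.tan (u / 2) = a at *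
  generalize Real.tan (h / 2) = b at *
  have h4 : a ^ 2 + b ^ 4 ≠ 0 := by positivity
  have h5 : 1 + (b ^ 2 / a) ^ 2 ≠ 0 := by positivity
  field_simp
  ring

lemma diffKernel_eq_tan {h v : ℝ} (hh : h ∈ Ioo 0 π) (hv : v ∈ Ioo 0 π) :
    diffKernel h v = Real.tan (h / 2) * (1 + Real.tan (v / 2) ^ 2) /
      (Real.tan (h / 2) ^ 2 - Real.tan (v / 2) ^ 2) := by
  have hch := cos_half_pos hh
  have hcv := cos_half_pos hv
  have e1 : Real.sin h = 2 * Real.sin (h / 2) * Real.cos (h / 2) := by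
    rw [← Real.sin_two_mul]; congr 1; ring
  have e2 : ∀ x : ℝ, Real.cos x = Real.cos (x / 2) ^ 2 - Real.sin (x / 2) ^ 2 := fun x => by
    rw [← Real.cos_two_mul']; congr 1; ring
  have e3 := Real.sin_sq_add_cos_sq (h / 2)
  have e4 := Real.sin_sq_add_cos_sq (v / 2)
  have e5 : Real.cos v - Real.cos h = 2 * (Real.sin (h / 2) ^ 2 * Real.cos (v / 2) ^ 2
      - Real.sin (v / 2) ^ 2 * Real.cos (h / 2) ^ 2) := by
    rw [e2 v, e2 h]
    linear_combination (-(Real.cos (v / 2) ^ 2 - Real.sin (v / 2) ^ 2)) * e3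
      + (Real.cos (h / 2) ^ 2 - Real.sin (h / 2) ^ 2) * e4
  have e6 : 1 + Real.tan (v / 2) ^ 2 = 1 / Real.cos (v / 2) ^ 2 := by
    rw [one_div, ← Real.inv_one_add_tan_sq hcv.ne', inv_inv]
  have e7 : Real.tan (h / 2) ^ 2 - Real.tan (v / 2) ^ 2 = (Real.cos v - Real.cos h) /
      (2 * Real.cos (v / 2) ^ 2 * Real.cos (h / 2) ^ 2) := by
    rw [e5, Real.tan_eq_sin_div_cos, Real.tan_eq_sin_div_cos]
    field_simp
  rw [diffKernel, e6, e7, e1, Real.tan_eq_sin_div_cos]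
  field_simp

lemma abs_reflectDeriv_mul_diffKernel {h u : ℝ} (hh : h ∈ Ioo 0 π) (hu : u ∈ Ioo 0 h) :
    |reflectDeriv h u| * diffKernel h (reflectPt h u) = -diffKernel h u := by
  have hu' : u ∈ Ioo 0 π := ⟨hu.1, hu.2.trans hh.2⟩
  have ha := tan_half_pos hu'
  have hb := tan_half_pos hh
  have hab : Real.tan (u / 2) < Real.tan (h / 2) :=
    Real.tan_lt_tan_of_lt_of_lt_pi_div_two (by linarith [hu.1, Real.pi_pos])
      (by linarith [hh.2]) (by linarith [hu.2])
  rw [diffKernel_eq_tan hh (reflectPt_mem hh hu'), diffKernel_eq_tan hh hu', tan_half_reflectPt,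
    reflectDeriv, abs_neg]
  generalize Real.tan (u / 2) = a at *
  generalize Real.tan (h / 2) = b at *
  rw [abs_of_pos (by positivity)]
  have h1 : b ^ 2 - a ^ 2 ≠ 0 := by nlinarith
  have h2 : a ^ 2 + b ^ 4 ≠ 0 := by positivity
  have h3 : b ^ 2 - (b ^ 2 / a) ^ 2 = -(b ^ 2 * (b ^ 2 - a ^ 2) / a ^ 2) := by
    field_simp
    ring
  rw [h3]
  field_simp

lemma diffKernel_pos {h u : ℝ} (hh : h ∈ Ioo 0 π) (hu : 0 ≤ u) (huh : u < h) :
    0 < diffKernel h u :=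
  div_pos (Real.sin_pos_of_mem_Ioo hh)
    (sub_pos.2 (Real.cos_lt_cos_of_nonneg_of_le_pi hu hh.2.le huh))

lemma diffKernel_neg {h u : ℝ} (hh : h ∈ Ioo 0 π) (hhu : h < u) (hu : u ≤ π) :
    diffKernel h u < 0 :=
  div_neg_of_pos_of_neg (Real.sin_pos_of_mem_Ioo hh)
    (sub_neg.2 (Real.cos_lt_cos_of_nonneg_of_le_pi hh.1.le hu hhu))

lemma setIntegral_reflectPt {h u : ℝ} (hh : h ∈ Ioo 0 π) (hu : u ∈ Ioc 0 h) (G : ℝ → ℝ) :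
    ∫ v in Ioo (reflectPt h u) π, G v * diffKernel h v =
      -∫ w in Ioo 0 u, G (reflectPt h w) * diffKernel h w := by
  have hu' : u ∈ Ioo 0 π := ⟨hu.1, hu.2.trans_lt hh.2⟩
  have hsub : Ioo 0 u ⊆ Ioo 0 π := Ioo_subset_Ioo_right hu'.2.le
  rw [← reflectPt_image hh hu', integral_image_eq_integral_abs_deriv_smul measurableSet_Ioo
    (fun x hx => (hasDerivAt_reflectPt h (hsub hx)).hasDerivWithinAt)
    ((reflectPt_strictAntiOn hh).injOn.mono hsub), ← integral_neg]
  refine setIntegral_congr_fun measurableSet_Ioo fun w hw => ?_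
  have := abs_reflectDeriv_mul_diffKernel hh ⟨hw.1, hw.2.trans_le hu.2⟩
  simp only [smul_eq_mul]
  linear_combination G (reflectPt h w) * this

lemma integrableOn_reflectPt {h : ℝ} (hh : h ∈ Ioo 0 π) {G : ℝ → ℝ}
    (hG : IntegrableOn (fun v => G v * diffKernel h v) (Ioo h π)) :
    IntegrableOn (fun w => G (reflectPt h w) * diffKernel h w) (Ioo 0 h) := by
  have hsub : Ioo 0 h ⊆ Ioo 0 π := Ioo_subset_Ioo_right hh.2.le
  have him := reflectPt_image hh hh
  rw [reflectPt_self hh] at him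
  rw [← him, integrableOn_image_iff_integrableOn_abs_deriv_smul measurableSet_Ioo
    (fun x hx => (hasDerivAt_reflectPt h (hsub hx)).hasDerivWithinAt)
    ((reflectPt_strictAntiOn hh).injOn.mono hsub)] at hG
  refine hG.neg.congr_fun (fun w hw => ?_) measurableSet_Ioo
  have := abs_reflectDeriv_mul_diffKernel hh hw
  simp only [smul_eq_mul, Pi.neg_apply]
  linear_combination -G (reflectPt h w) * this

lemma intervalIntegrable_diffKernel {h a : ℝ} (hh : h ∈ Ioo 0 π) (ha : h < a) (haπ : a ≤ π)
    {b : ℝ} (hb : h < b) (hbπ : b ≤ π) : IntervalIntegrable (diffKernel h) volume a b := by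
  apply ContinuousOn.intervalIntegrable
  unfold diffKernel
  refine continuousOn_const.div (by fun_prop) fun x hx => ?_
  have hx1 : h < x := (lt_min ha hb).trans_le hx.1
  have hx2 : x ≤ π := hx.2.trans (max_le haπ hbπ)
  exact (sub_neg.2 (Real.cos_lt_cos_of_nonneg_of_le_pi hh.1.le hx2 hx1)).ne

lemma eq_reflectPt {h u r : ℝ} (hh : h ∈ Ioo 0 π) (hu : u ∈ Ioo 0 h) (hr : r ∈ Ioo h π)
    (hint : ∫ v in (0:ℝ)..u, diffKernel h v = -∫ v in r..π, diffKernel h v) :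
    r = reflectPt h u := by
  have hu' : u ∈ Ioo 0 π := ⟨hu.1, hu.2.trans hh.2⟩
  have hR : h < reflectPt h u := by
    simpa only [reflectPt_self hh] using reflectPt_strictAntiOn hh hu' hh hu.2
  have hRπ := (reflectPt_mem hh hu').2
  have key := setIntegral_reflectPt hh ⟨hu.1, hu.2.le⟩ (fun _ => 1)
  simp only [one_mul] at key
  rw [← integral_Ioc_eq_integral_Ioo, ← integral_Ioc_eq_integral_Ioo,
    ← intervalIntegral.integral_of_le hRπ.le, ← intervalIntegral.integral_of_le hu.1.le] at key
  have hzero : ∀ a b : ℝ, h < a → b ≤ π → a < b →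
      ∫ v in a..π, diffKernel h v = ∫ v in b..π, diffKernel h v → False := by
    intro a b ha hb hab heq
    have h1 := intervalIntegral.integral_add_adjacent_intervals
      (intervalIntegrable_diffKernel hh ha (hab.le.trans hb) (ha.trans hab) hb)
      (intervalIntegrable_diffKernel hh (ha.trans hab) hb hh.2 le_rfl)
    have h2 := intervalIntegral.intervalIntegral_pos_of_pos_on
      (intervalIntegrable_diffKernel hh ha (hab.le.trans hb) (ha.trans hab) hb).neg
      (fun x hx => neg_pos.2 (diffKernel_neg hh (ha.trans hx.1) (hx.2.le.trans hb))) hab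
    simp only [Pi.neg_apply, intervalIntegral.integral_neg] at h2
    linarith
  rcases lt_trichotomy r (reflectPt h u) with hlt | heq | hlt
  · exact (hzero _ _ hr.1 hRπ.le hlt (by linarith)).elim
  · exact heq
  · exact (hzero _ _ hR hr.2.le hlt (by linarith)).elim

/-- The conjugation kernel `cot (s / 2) / 2`. -/
def conjKernel (s : ℝ) : ℝ := Real.cos (s / 2) / (2 * Real.sin (s / 2))

lemma div_two_tan_half (x s : ℝ) : x / (2 * Real.tan (s / 2)) = x * conjKernel s := by
  rw [conjKernel, Real.tan_eq_sin_div_cos, div_eq_mul_inv x, ← mul_div_assoc, inv_div]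

lemma conjKernel_neg (s : ℝ) : conjKernel (-s) = -conjKernel s := by
  rw [conjKernel, conjKernel, neg_div, Real.cos_neg, Real.sin_neg, mul_neg, div_neg]

lemma conjKernel_periodic : Function.Periodic conjKernel (2 * π) := by
  intro s
  have h1 : (s + 2 * π) / 2 = s / 2 + π := by ring
  rw [conjKernel, conjKernel, h1, Real.cos_add_pi, Real.sin_add_pi, mul_neg, neg_div_neg_eq]

lemma measurable_conjKernel : Measurable conjKernel := by
  unfold conjKernel
  fun_prop

lemma sin_half_ne_zero {s : ℝ} (h0 : s ≠ 0) (hs : |s| < 2 * π) : Real.sin (s / 2) ≠ 0 := by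
  rw [abs_lt] at hs
  rcases lt_or_gt_of_ne h0 with h | h
  · exact (Real.sin_neg_of_neg_of_neg_pi_lt (by linarith) (by linarith)).ne
  · exact (Real.sin_pos_of_pos_of_lt_pi (by linarith) (by linarith)).ne'

lemma continuousOn_conjKernel : ContinuousOn conjKernel {s | s ≠ 0 ∧ |s| < 2 * π} := by
  unfold conjKernel
  exact ContinuousOn.div (by fun_prop) (by fun_prop)
    fun s hs => mul_ne_zero two_ne_zero (sin_half_ne_zero hs.1 hs.2)

lemma conjKernel_add_sub {h v : ℝ} (hh : h ∈ Ioo 0 π) (hv : v ∈ Ioo 0 π) (hvh : v ≠ h) :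
    conjKernel (v + h) - conjKernel (v - h) = diffKernel h v := by
  have h1 : Real.sin ((v + h) / 2) ≠ 0 :=
    sin_half_ne_zero (by linarith [hh.1, hv.1])
      (abs_lt.2 ⟨by linarith [hh.1, hv.1, Real.pi_pos], by linarith [hh.2, hv.2]⟩)
  have h2 : Real.sin ((v - h) / 2) ≠ 0 :=
    sin_half_ne_zero (sub_ne_zero.2 hvh)
      (abs_lt.2 ⟨by linarith [hh.2, hv.1, Real.pi_pos], by linarith [hh.1, hv.2, Real.pi_pos]⟩)
  have h3 : Real.sin h = Real.sin ((v + h) / 2) * Real.cos ((v - h) / 2) -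
      Real.cos ((v + h) / 2) * Real.sin ((v - h) / 2) := by
    rw [← Real.sin_sub]; congr 1; ring
  have h4 : Real.cos v - Real.cos h = -2 * Real.sin ((v + h) / 2) * Real.sin ((v - h) / 2) := by
    rw [Real.cos_sub_cos]
  rw [diffKernel, h4, h3, conjKernel, conjKernel]
  field_simp
  ring

lemma abs_conjKernel_le {s : ℝ} (hs : s ∈ Ioo 0 π) : |conjKernel s| ≤ 1 / s := by
  have h1 : s / 2 ≤ Real.tan (s / 2) := Real.le_tan (by linarith [hs.1]) (by linarith [hs.2])
  have h2 : 0 < Real.tan (s / 2) := tan_half_pos hs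
  rw [← one_mul (conjKernel s), ← div_two_tan_half, abs_of_pos (by positivity)]
  exact one_div_le_one_div_of_le hs.1 (by linarith)

lemma integrableOn_modulus_mul_conjKernel {ω : ℝ → ℝ} (hω : IsConcaveModulus ω)
    (hd : DiniCondition ω) :
    IntegrableOn (fun s => ω |s| * conjKernel s) (Ioc (-π) π) := by
  obtain ⟨hc, -, -, -, hnn, -⟩ := hω
  obtain ⟨ε, hε, hint⟩ := hd
  have h1 : IntegrableOn (fun s => ω s / s) (Ioo 0 π) := by
    have h2 : IntegrableOn (fun s => ω s / s) (Icc ε π) :=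
      (hc.continuousOn.div continuousOn_id fun s hs => (hε.trans_le hs.1).ne').integrableOn_Icc
    refine (hint.union h2).mono_set fun s hs => ?_
    rcases lt_or_ge s ε with h | h
    · exact Or.inl ⟨hs.1, h⟩
    · exact Or.inr ⟨h, hs.2.le⟩
  have hmeas : Measurable fun s => ω |s| * conjKernel s :=
    (hc.measurable.comp measurable_norm).mul measurable_conjKernel
  have hpos : IntegrableOn (fun s => ω |s| * conjKernel s) (Ioo 0 π) := by
    refine Integrable.mono' h1 hmeas.aestronglyMeasurable ?_
    refine (ae_restrict_iff' measurableSet_Ioo).2 (Eventually.of_forall fun s hs => ?_)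
    rw [Real.norm_eq_abs, abs_mul, abs_of_pos hs.1, abs_of_nonneg (hnn s hs.1.le), div_eq_mul_one_div]
    exact mul_le_mul_of_nonneg_left (abs_conjKernel_le hs) (hnn s hs.1.le)
  have hneg : IntegrableOn (fun s => ω |s| * conjKernel s) (Ioo (-π) 0) := by
    have h3 := hpos.comp_neg.neg
    rw [Set.neg_Ioo, neg_zero] at h3
    refine h3.congr_fun (fun s _ => ?_) measurableSet_Ioo
    simp only [Pi.neg_apply, abs_neg, conjKernel_neg, mul_neg, neg_neg]
  have h0 : IntegrableOn (fun s => ω |s| * conjKernel s) (Ioc (-π) 0) :=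
    (integrableOn_Ioc_iff_integrableOn_Ioo).2 hneg
  have h4 := h0.union ((integrableOn_Ioc_iff_integrableOn_Ioo).2 hpos)
  rwa [Ioc_union_Ioc_eq_Ioc (by linarith [Real.pi_pos]) Real.pi_pos.le] at h4

lemma MemH.continuous {ω f : ℝ → ℝ} (hω : IsConcaveModulus ω) (hf : MemH ω f) : Continuous f := by
  rw [continuous_iff_continuousAt]
  intro x
  rw [ContinuousAt, tendsto_iff_norm_sub_tendsto_zero]
  have h1 : Tendsto (fun y => ω |y - x|) (nhds x) (nhds 0) := by
    have h2 : Continuous fun y => ω |y - x| := hω.1.comp (by fun_prop)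
    simpa [hω.2.2.1] using h2.tendsto x
  exact squeeze_zero (fun _ => norm_nonneg _) (fun y => hf.2 y x) h1

lemma integrableOn_sub_mul_conjKernel {ω f : ℝ → ℝ} (hω : IsConcaveModulus ω)
    (hd : DiniCondition ω) (hf : MemH ω f) (y : ℝ) :
    IntegrableOn (fun s => (f (y + s) - f y) * conjKernel s) (Ioc (-π) π) := by
  have hfc := hf.continuous hω
  refine Integrable.mono (integrableOn_modulus_mul_conjKernel hω hd)
    (Measurable.aestronglyMeasurable ?_) (Eventually.of_forall fun s => ?_)
  · exact ((hfc.comp (continuous_const.add continuous_id)).sub continuous_const).measurable.mul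
      measurable_conjKernel
  · rw [norm_mul, norm_mul]
    refine mul_le_mul_of_nonneg_right ?_ (norm_nonneg _)
    have h1 := hf.2 (y + s) y
    rw [add_sub_cancel_left] at h1
    exact h1.trans (le_abs_self _)

/-- The conjugate is an absolutely convergent integral after subtracting a constant. -/
lemma ConjAt.eq_integral {ω f : ℝ → ℝ} (hω : IsConcaveModulus ω) (hd : DiniCondition ω)
    (hf : MemH ω f) {y L : ℝ} (hL : ConjAt f y L) :
    L = -(1 / π) * ∫ s in (-π)..π, (f (y + s) - f y) * conjKernel s := by
  have hpi := Real.pi_pos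
  have hfc := hf.continuous hω
  set E : ℝ → ℝ := fun s => (f (y + s) - f y) * conjKernel s with hE
  have hEint := integrableOn_sub_mul_conjKernel hω hd hf y
  have hEint' : IntegrableOn E (Icc (-π) π) := (integrableOn_Icc_iff_integrableOn_Ioc).2 hEint
  have hmS : ∀ δ : ℝ, MeasurableSet {s : ℝ | δ ≤ |s| ∧ |s| ≤ π} := fun δ =>
    ((isClosed_le continuous_const continuous_abs).inter
      (isClosed_le continuous_abs continuous_const)).measurableSet
  have htrunc : ∀ δ : ℝ, 0 < δ →
      ∫ t in {t : ℝ | δ ≤ |t - y| ∧ |t - y| ≤ π}, f t / (2 * Real.tan ((t - y) / 2)) =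
        ∫ s in Icc (-π) π, {s : ℝ | δ ≤ |s|}.indicator E s := by
    intro δ hδ
    set S : Set ℝ := {s : ℝ | δ ≤ |s| ∧ |s| ≤ π} with hS
    have hcomp : IsCompact S := by
      refine Metric.isCompact_of_isClosed_isBounded
        ((isClosed_le continuous_const continuous_abs).inter
          (isClosed_le continuous_abs continuous_const)) ?_
      exact (Metric.isBounded_Icc (-π) π).subset fun s hs => abs_le.1 hs.2
    have hK : ContinuousOn conjKernel S := continuousOn_conjKernel.mono fun s hs =>
      ⟨abs_pos.1 (hδ.trans_le hs.1), by linarith [hs.2]⟩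
    have hi1 : IntegrableOn (fun s => f (y + s) * conjKernel s) S :=
      ((hfc.comp (continuous_const.add continuous_id)).continuousOn.mul hK).integrableOn_compact
        hcomp
    have hi2 : IntegrableOn (fun s => f y * conjKernel s) S :=
      (continuousOn_const.mul hK).integrableOn_compact hcomp
    have hodd : ∫ s in S, f y * conjKernel s = 0 := by
      have h1 := integral_neg_eq_self (S.indicator fun s => f y * conjKernel s) volume
      have h2 : (fun s => S.indicator (fun s => f y * conjKernel s) (-s)) =
          fun s => -S.indicator (fun s => f y * conjKernel s) s := by
        funext s
        have h3 : (-s ∈ S) ↔ s ∈ S := by simp only [hS, mem_ofPred_eq, abs_neg]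
        by_cases h4 : s ∈ S
        · rw [indicator_of_mem h4, indicator_of_mem (h3.2 h4), conjKernel_neg, mul_neg]
        · rw [indicator_of_notMem h4, indicator_of_notMem (mt h3.1 h4), neg_zero]
      rw [h2, integral_neg, integral_indicator (hmS δ)] at h1
      linarith
    calc ∫ t in {t : ℝ | δ ≤ |t - y| ∧ |t - y| ≤ π}, f t / (2 * Real.tan ((t - y) / 2))
        = ∫ s in S, f (y + s) * conjKernel s := by
          have hm : MeasurableSet {t : ℝ | δ ≤ |t - y| ∧ |t - y| ≤ π} :=
            (measurable_id.sub_const y) (hmS δ)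
          rw [← integral_indicator hm, ← integral_indicator (hmS δ),
            ← integral_add_left_eq_self _ y]
          refine integral_congr_ae (Eventually.of_forall fun s => ?_)
          simp only [indicator_apply, mem_ofPred_eq, add_sub_cancel_left, div_two_tan_half]
      _ = ∫ s in S, E s := by
          rw [← sub_zero (∫ s in S, f (y + s) * conjKernel s), ← hodd, ← integral_sub hi1 hi2]
          simp only [hE, sub_mul]
      _ = ∫ s in Icc (-π) π, {s : ℝ | δ ≤ |s|}.indicator E s := by
          rw [setIntegral_indicator (isClosed_le continuous_const continuous_abs).measurableSet]
          congr 2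
          ext s
          simp only [hS, mem_ofPred_eq, mem_inter_iff, mem_Icc, abs_le, and_comm]
  have hlim : Tendsto (fun δ : ℝ => ∫ s in Icc (-π) π, {s : ℝ | δ ≤ |s|}.indicator E s)
      (nhdsWithin 0 (Ioi 0)) (nhds (∫ s in Icc (-π) π, E s)) := by
    refine tendsto_integral_filter_of_dominated_convergence (fun s => ‖E s‖)
      (Eventually.of_forall fun δ => hEint'.aestronglyMeasurable.indicator
        (isClosed_le continuous_const continuous_abs).measurableSet)
      (Eventually.of_forall fun δ => Eventually.of_forall fun s => norm_indicator_le_norm_self _ _)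
      hEint'.norm ?_
    refine ae_restrict_of_ae ?_
    filter_upwards [compl_mem_ae_iff.2 (measure_singleton (0 : ℝ))] with s hs
    refine tendsto_const_nhds.congr' ?_
    have h1 : ∀ᶠ δ : ℝ in nhdsWithin 0 (Ioi 0), δ < |s| :=
      nhdsWithin_le_nhds (eventually_lt_nhds (abs_pos.2 hs))
    filter_upwards [h1] with δ hδ
    exact (indicator_of_mem (s := {s : ℝ | δ ≤ |s|}) hδ.le E).symm
  have h2 : ConjAt f y (-(1 / π) * ∫ s in Icc (-π) π, E s) := by
    refine (hlim.const_mul (-(1 / π))).congr' ?_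
    filter_upwards [self_mem_nhdsWithin] with δ hδ
    rw [htrunc δ hδ]
  rw [tendsto_nhds_unique hL h2, intervalIntegral.integral_of_le (by linarith),
    integral_Icc_eq_integral_Ioc]

lemma integrableOn_modulus_mul_diffKernel {ω : ℝ → ℝ} (hω : IsConcaveModulus ω)
    (hd : DiniCondition ω) {h : ℝ} (hh : h ∈ Ioo 0 π) :
    IntegrableOn (fun v => ω |v - h| * diffKernel h v) (Ioo 0 π) := by
  have hc : Continuous fun v => ω |v - h| := hω.1.comp (by fun_prop)
  have h1 : IntegrableOn (fun v => ω |v - h| * conjKernel (v + h)) (Ioo 0 π) := by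
    refine IntegrableOn.mono_set (ContinuousOn.integrableOn_Icc ?_) Ioo_subset_Icc_self
    refine hc.continuousOn.mul (continuousOn_conjKernel.comp (by fun_prop) fun v hv => ?_)
    exact ⟨by linarith [hh.1, hv.1],
      abs_lt.2 ⟨by linarith [hh.1, hv.1, Real.pi_pos], by linarith [hh.2, hv.2]⟩⟩
  have h2 : IntegrableOn (fun v => ω |v - h| * conjKernel (v - h)) (Ioo 0 π) := by
    have h3 : IntervalIntegrable (fun s => ω |s| * conjKernel s) volume (-h) (π - h) := by
      rw [intervalIntegrable_iff_integrableOn_Ioc_of_le (by linarith [Real.pi_pos])]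
      exact (integrableOn_modulus_mul_conjKernel hω hd).mono_set
        (Ioc_subset_Ioc (by linarith [hh.2]) (by linarith [hh.1]))
    have h4 := h3.comp_sub_right h
    rwa [neg_add_cancel, sub_add_cancel,
      intervalIntegrable_iff_integrableOn_Ioo_of_le Real.pi_pos.le] at h4
  refine (h1.sub h2).congr_fun (fun v hv => ?_) measurableSet_Ioo
  rcases eq_or_ne v h with rfl | hvh
  · simp [hω.2.2.1]
  · simp only [Pi.sub_apply, ← conjKernel_add_sub hh hv hvh]
    ring

lemma conj_sub_eq_integral {ω f g : ℝ → ℝ} (hω : IsConcaveModulus ω) (hd : DiniCondition ω)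
    (hf : MemH ω f) (hg : ConjFn f g) {h : ℝ} (hh : h ∈ Ioo 0 π) (c : ℝ) :
    g (c + h) - g (c - h) = 1 / π * ∫ u in Ioo 0 h,
      ((f (c + u) + f (c - u)) - (f (c + reflectPt h u) + f (c - reflectPt h u))) *
        diffKernel h u := by
  have hpi := Real.pi_pos
  set F : ℝ → ℝ := fun v => f (c + v) + f (c - v) with hF
  set D : ℝ → ℝ := fun s => (F (h + s) - F h) * conjKernel s with hD
  set Q : ℝ → ℝ := fun v => (F v - F h) * diffKernel h v with hQ
  have hle : -π ≤ π := by linarith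
  have hE : ∀ y, IntervalIntegrable (fun s => (f (y + s) - f y) * conjKernel s) volume (-π) π :=
    fun y => (intervalIntegrable_iff_integrableOn_Ioc_of_le hle).2
      (integrableOn_sub_mul_conjKernel hω hd hf y)
  have hEneg : IntervalIntegrable
      (fun s => (f (c - h + -s) - f (c - h)) * conjKernel (-s)) volume (-π) π := by
    have h1 := ((IntervalIntegrable.iff_comp_neg).1 (hE (c - h))).symm
    rwa [neg_neg] at h1
  have hDeq : D = fun s => (f (c + h + s) - f (c + h)) * conjKernel s -
      (f (c - h + -s) - f (c - h)) * conjKernel (-s) := by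
    funext s
    simp only [hD, hF, conjKernel_neg]
    rw [show c + (h + s) = c + h + s by ring, show c - (h + s) = c - h + -s by ring]
    ring
  have hDint : IntervalIntegrable D volume (-π) π := by
    rw [hDeq]
    exact (hE (c + h)).sub hEneg
  have hgD : g (c + h) - g (c - h) = -(1 / π) * ∫ s in (-π)..π, D s := by
    have h1 := intervalIntegral.integral_comp_neg (a := -π) (b := π)
      (fun s => (f (c - h + s) - f (c - h)) * conjKernel s)
    rw [neg_neg] at h1
    rw [(hg (c + h)).eq_integral hω hd hf, (hg (c - h)).eq_integral hω hd hf, ← h1, hDeq,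
      intervalIntegral.integral_sub (hE (c + h)) hEneg]
    ring
  have hDper : Function.Periodic D (2 * π) := by
    intro s
    simp only [hD, hF]
    rw [conjKernel_periodic s, show c + (h + (s + 2 * π)) = c + (h + s) + 2 * π by ring, hf.1,
      show c - (h + (s + 2 * π)) = c - (h + s) - 2 * π by ring, hf.1.sub_eq]
  have hDall : ∀ a b, IntervalIntegrable D volume a b :=
    hDper.intervalIntegrable (t := -π) (by positivity) (by convert hDint using 1; ring)
  have hPall : ∀ a b, IntervalIntegrable (fun v => D (v - h)) volume a b := fun a b => by
    simpa only [sub_add_cancel] using (hDall (a - h) (b - h)).comp_sub_right h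
  have hPnegall : ∀ a b, IntervalIntegrable (fun v => D (-v - h)) volume a b := fun a b => by
    simpa only [neg_neg] using (IntervalIntegrable.iff_comp_neg).1 (hPall (-a) (-b))
  have hshift : ∫ s in (-π)..π, D s = ∫ v in (0:ℝ)..π, (D (v - h) + D (-v - h)) := by
    have h1 := intervalIntegral.integral_comp_neg (a := 0) (b := π) (fun v => D (v - h))
    rw [neg_zero] at h1
    have h2 := hDper.intervalIntegral_add_eq (-π) (-π - h)
    rw [show -π + 2 * π = π by ring, show -π - h + 2 * π = π - h by ring] at h2
    rw [intervalIntegral.integral_add (hPall 0 π) (hPnegall 0 π), h1, add_comm,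
      intervalIntegral.integral_add_adjacent_intervals (hPall _ _) (hPall _ _),
      intervalIntegral.integral_comp_sub_right, h2]
  have hPQ : ∀ v ∈ Ioo 0 π, D (v - h) + D (-v - h) = -Q v := by
    intro v hv
    have h1 : F (-v) = F v := by
      simp only [hF, sub_neg_eq_add, ← sub_eq_add_neg]
      ring
    simp only [hD, hQ, add_sub_cancel]
    rw [h1, ← neg_add', conjKernel_neg]
    rcases eq_or_ne v h with rfl | hvh
    · simp
    · rw [← conjKernel_add_sub hh hv hvh]
      ring
  have hQint : IntegrableOn Q (Ioo 0 π) := by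
    have h1 := ((intervalIntegrable_iff_integrableOn_Ioo_of_le hpi.le).1
      ((hPall 0 π).add (hPnegall 0 π))).neg
    refine h1.congr_fun (fun v hv => ?_) measurableSet_Ioo
    simp only [Pi.neg_apply, hPQ v hv, neg_neg]
  have hQl : IntegrableOn Q (Ioo 0 h) := hQint.mono_set (Ioo_subset_Ioo_right hh.2.le)
  have hQr : IntegrableOn Q (Ioo h π) := hQint.mono_set (Ioo_subset_Ioo_left hh.1.le)
  have hsplit : ∫ v in Ioo 0 π, Q v = (∫ v in Ioo 0 h, Q v) + ∫ v in Ioo h π, Q v := by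
    simp only [← integral_Ioc_eq_integral_Ioo]
    rw [← Ioc_union_Ioc_eq_Ioc hh.1.le hh.2.le]
    exact setIntegral_union (Ioc_disjoint_Ioc_of_le le_rfl) measurableSet_Ioc
      ((integrableOn_Ioc_iff_integrableOn_Ioo).2 hQl)
      ((integrableOn_Ioc_iff_integrableOn_Ioo).2 hQr)
  have hchange := setIntegral_reflectPt hh ⟨hh.1, le_rfl⟩ (fun v => F v - F h)
  rw [reflectPt_self hh] at hchange
  have hrefl := integrableOn_reflectPt hh hQr
  rw [hgD, hshift, intervalIntegral.integral_of_le hpi.le, integral_Ioc_eq_integral_Ioo,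
    setIntegral_congr_fun measurableSet_Ioo hPQ, integral_neg, neg_mul_neg, hsplit, hchange,
    ← sub_eq_add_neg, ← integral_sub hQl hrefl]
  congr 2
  funext u
  simp only [hQ]
  ring

lemma integrableOn_diffKernel_mul_modulus {ω : ℝ → ℝ} (hω : IsConcaveModulus ω)
    (hd : DiniCondition ω) {h : ℝ} (hh : h ∈ Ioo 0 π) :
    IntegrableOn (fun u => diffKernel h u * ω (reflectPt h u - u)) (Ioo 0 h) := by
  have hbase := integrableOn_modulus_mul_diffKernel hω hd hh
  have hl := hbase.mono_set (Ioo_subset_Ioo_right hh.2.le)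
  have hr := integrableOn_reflectPt hh (hbase.mono_set (Ioo_subset_Ioo_left hh.1.le))
  obtain ⟨hc, -, -, hsub, hnn, -⟩ := hω
  refine Integrable.mono' (hl.add hr) (Measurable.aestronglyMeasurable ?_) ?_
  · have h1 : Measurable (reflectPt h) := by
      unfold reflectPt
      simp only [Real.tan_eq_sin_div_cos]
      fun_prop
    have h2 : Measurable (diffKernel h) := by
      unfold diffKernel
      fun_prop
    exact h2.mul (hc.measurable.comp (h1.sub measurable_id))
  · refine (ae_restrict_iff' measurableSet_Ioo).2 (Eventually.of_forall fun u hu => ?_)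
    have hR : h < reflectPt h u := by
      simpa only [reflectPt_self hh] using
        reflectPt_strictAntiOn hh ⟨hu.1, hu.2.trans hh.2⟩ hh hu.2
    have hk := diffKernel_pos hh hu.1.le hu.2
    have h3 := hsub (h - u) (reflectPt h u - h) (by linarith [hu.2]) (by linarith)
    rw [show h - u + (reflectPt h u - h) = reflectPt h u - u by ring] at h3
    rw [Real.norm_eq_abs, abs_of_nonneg (mul_nonneg hk.le (hnn _ (by linarith [hu.2])))]
    simp only [Pi.add_apply]
    rw [abs_sub_comm u h, abs_of_pos (sub_pos.2 hu.2), abs_of_pos (sub_pos.2 hR)]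
    nlinarith

/-- sharp estimate for the modulus of continuity of the conjugate. -/
theorem conj_modulus_bound (ω : ℝ → ℝ) (hω : IsConcaveModulus ω) (hd : DiniCondition ω)
    (t : ℝ) (ht : t ∈ Ioo 0 (2 * π)) (ρ : ℝ → ℝ)
    (hρ : ∀ u ∈ Ioo 0 (t / 2), ρ u ∈ Ioo (t / 2) π ∧
      (∫ v in (0:ℝ)..u, Real.sin (t / 2) / (Real.cos v - Real.cos (t / 2))) =
        -∫ v in (ρ u)..π, Real.sin (t / 2) / (Real.cos v - Real.cos (t / 2)))
    (f g : ℝ → ℝ) (hf : MemH ω f) (hg : ConjFn f g) :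
    ∀ x : ℝ, |g (x + t) - g x| ≤
      (2 / π) * ∫ u in (0:ℝ)..(t / 2),
        (Real.sin (t / 2) / (Real.cos u - Real.cos (t / 2))) * ω (ρ u - u) := by
  intro x
  have hh : t / 2 ∈ Ioo 0 π := ⟨by linarith [ht.1], by linarith [ht.2]⟩
  set h := t / 2 with hht
  have hρR : ∀ u ∈ Ioo 0 h, ρ u = reflectPt h u := fun u hu =>
    eq_reflectPt hh hu (hρ u hu).1 (hρ u hu).2
  have hdiff := conj_sub_eq_integral hω hd hf hg hh (x + h)
  rw [show x + h + h = x + t by rw [hht]; ring, add_sub_cancel_right] at hdiff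
  have hrhs : ∫ u in (0:ℝ)..h, Real.sin h / (Real.cos u - Real.cos h) * ω (ρ u - u) =
      ∫ u in Ioo 0 h, diffKernel h u * ω (reflectPt h u - u) := by
    rw [intervalIntegral.integral_of_le hh.1.le, integral_Ioc_eq_integral_Ioo]
    refine setIntegral_congr_fun measurableSet_Ioo fun u hu => ?_
    simp only [hρR u hu, diffKernel]
  rw [hdiff, hrhs, abs_mul, abs_of_pos (by positivity), div_mul_eq_mul_div, div_mul_eq_mul_div,
    one_mul]
  refine div_le_div_of_nonneg_right ?_ Real.pi_pos.le
  rw [← integral_const_mul, ← Real.norm_eq_abs]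
  refine norm_integral_le_of_norm_le ((integrableOn_diffKernel_mul_modulus hω hd hh).const_mul 2)
    ((ae_restrict_iff' measurableSet_Ioo).2 (Eventually.of_forall fun u hu => ?_))
  have huR : u < reflectPt h u := hu.2.trans (hρR u hu ▸ (hρ u hu).1.1)
  have hk := diffKernel_pos hh hu.1.le hu.2
  have h1 := hf.2 (x + h + u) (x + h + reflectPt h u)
  have h2 := hf.2 (x + h - u) (x + h - reflectPt h u)
  rw [add_sub_add_left_eq_sub, abs_sub_comm u, abs_of_pos (sub_pos.2 huR)] at h1
  rw [sub_sub_sub_cancel_left, abs_of_pos (sub_pos.2 huR)] at h2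
  rw [norm_mul, Real.norm_eq_abs, Real.norm_eq_abs, abs_of_pos hk, add_sub_add_comm]
  have h3 := (abs_add_le _ _).trans (add_le_add h1 h2)
  nlinarith
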